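/- Let A be an integral domain of characteristic p with a p-basis, with fraction field F, such that Ω¹_A injects into Ω¹_F. Then Ω¹_A ∩ B_{n,F} = B_{n,A} for all n ≥ 0; in particular the natural map Ω¹_A/B_{n,A} → Ω¹_F/B_{n,F} is injective. -/

import Mathlib

/-- A `p`-basis of a commutative ring `A` of characteristic `p`. -/
def IsPBasis (p : ℕ) {A : Type*} [CommRing A] (Γ : Set A) : Prop :=
  Subring.closure ((Set.range fun a : A => a ^ p) ∪ Γ) = ⊤ ∧
  ∀ (k : ℕ) (a : Fin k → A), Function.Injective a → (∀ i, a i ∈ Γ) →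
    ∀ c : (Fin k → Fin p) → A,
      (∀ m, c m ∈ Subring.closure (Set.range fun x : A => x ^ p)) →
      (∑ m : Fin k → Fin p, c m * ∏ i, a i ^ (m i : ℕ)) = 0 →
      ∀ m, c m = 0

/-- `B_{n,R} ⊆ Ω¹_R`: the image of `D_n : W_n(R) → Ω¹_R`, i.e. the set of forms
`d f_{n-1} + f_{n-2}^{p-1} d f_{n-2} + ⋯ + f₀^{p^{n-1}-1} d f₀`. -/
def BnSet (p n : ℕ) (R : Type*) [CommRing R] : Set (Ω[R⁄ℤ]) :=
  {w | ∃ f : Fin n → R, w = ∑ i : Fin n,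
    (f i) ^ (p ^ (n - 1 - (i : ℕ)) - 1) • KaehlerDifferential.D ℤ R (f i)}

open KaehlerDifferential

theorem Module.Basis.smul_left_cancel {ι S M : Type*} [CommRing S] [IsDomain S] [AddCommGroup M]
    [Module S M] (b : Module.Basis ι S M) {c : S} (hc : c ≠ 0) {v w : M} (h : c • v = c • w) :
    v = w := by
  refine b.ext_elem fun i => mul_left_cancel₀ hc ?_
  simpa using DFunLike.congr_fun (congrArg b.repr h) i

theorem exists_add_pow_smul_D (p : ℕ) [hp : Fact p.Prime] {R : Type*} [CommRing R] (x y : R) :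
    ∃ z : R, (x + y) ^ (p - 1) • D ℤ R (x + y) =
      x ^ (p - 1) • D ℤ R x + y ^ (p - 1) • D ℤ R y + D ℤ R z := by
  let U := MvPolynomial (Fin 2) ℤ
  let X : U := MvPolynomial.X 0
  let Y : U := MvPolynomial.X 1
  obtain ⟨r, hr⟩ := exists_add_pow_prime_eq hp.out X Y
  have key : (X + Y) ^ (p - 1) • D ℤ U (X + Y) =
      X ^ (p - 1) • D ℤ U X + Y ^ (p - 1) • D ℤ U Y + D ℤ U (X * Y * r) := by
    have h := congrArg (D ℤ U) hr
    have h2 : (p : U) • ((X + Y) ^ (p - 1) • D ℤ U (X + Y)) =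
      (p : U) • (X ^ (p - 1) • D ℤ U X + Y ^ (p - 1) • D ℤ U Y + D ℤ U (X * Y * r)) := by
      rw [mul_assoc (p : U) X, mul_assoc (p : U)] at h
      simp only [map_add, Derivation.leibniz_pow, Derivation.leibniz _ (p : U),
        Derivation.map_natCast, smul_zero, add_zero] at h
      simpa only [map_add, smul_add, Nat.cast_smul_eq_nsmul] using h
    exact (KaehlerDifferential.mvPolynomialBasis ℤ (Fin 2)).smul_left_cancel
      (Nat.cast_ne_zero.mpr hp.out.ne_zero) h2
  let _ : Algebra U R := (MvPolynomial.aeval ![x, y] : U →ₐ[ℤ] R).toRingHom.toAlgebra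
  have hX : algebraMap U R X = x := by
    change (MvPolynomial.aeval ![x, y] : U →ₐ[ℤ] R) X = x
    simp [X]
  have hY : algebraMap U R Y = y := by
    change (MvPolynomial.aeval ![x, y] : U →ₐ[ℤ] R) Y = y
    simp [Y]
  refine ⟨algebraMap U R (X * Y * r), ?_⟩
  have := congrArg (KaehlerDifferential.map ℤ ℤ U R) key
  simp only [map_add, map_smul, KaehlerDifferential.map_D, hX, hY,
    ← algebraMap_smul R (_ : U) (_ : Ω[R⁄ℤ]), map_pow] at this
  simpa only [map_add] using this

/-- The subgroup `dR` of exact forms. -/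
noncomputable abbrev exactForms (R : Type*) [CommRing R] : AddSubgroup (Ω[R⁄ℤ]) :=
  (D ℤ R : R →ₗ[ℤ] Ω[R⁄ℤ]).toAddMonoidHom.range

theorem D_pow_char (p : ℕ) {R : Type*} [CommRing R] [CharP R p] (x : R) :
    D ℤ R (x ^ p) = 0 := by
  rw [Derivation.leibniz_pow, ← Nat.cast_smul_eq_nsmul R, CharP.cast_eq_zero, zero_smul]

theorem D_pow_char_mul (p : ℕ) {R : Type*} [CommRing R] [CharP R p] (x y : R) :
    D ℤ R (x ^ p * y) = x ^ p • D ℤ R y := by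
  rw [Derivation.leibniz, D_pow_char, smul_zero, add_zero]

theorem exists_inverseCartier (p : ℕ) [hp : Fact p.Prime] (R : Type*) [CommRing R] [CharP R p] :
    ∃ φ : Ω[R⁄ℤ] →+ Ω[R⁄ℤ] ⧸ exactForms R, ∀ a x : R,
      φ (a • D ℤ R x) = QuotientAddGroup.mk ((a ^ p * x ^ (p - 1)) • D ℤ R x) := by
  let s : R → (Ω[R⁄ℤ] ⧸ exactForms R) →+ (Ω[R⁄ℤ] ⧸ exactForms R) := fun a =>
    QuotientAddGroup.map _ _ (DistribSMul.toAddMonoidHom (Ω[R⁄ℤ]) (a ^ p)) (by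
      rintro _ ⟨x, rfl⟩
      exact ⟨a ^ p * x, D_pow_char_mul p a x⟩)
  have hs : ∀ a w, s a (QuotientAddGroup.mk w) = QuotientAddGroup.mk (a ^ p • w) :=
    fun _ _ => rfl
  let _ : Module R (Ω[R⁄ℤ] ⧸ exactForms R) := 
    { smul := fun a w => s a w
      one_smul := by
        rintro ⟨w⟩
        exact (hs 1 w).trans (by rw [one_pow, one_smul]; rfl)
      mul_smul := by
        rintro a b ⟨w⟩
        exact (hs _ w).trans (by rw [mul_pow, mul_smul]; rfl)
      smul_zero := fun a => map_zero (s a)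
      smul_add := fun a => map_add (s a)
      add_smul := by
        rintro a b ⟨w⟩
        exact (hs _ w).trans (by rw [add_pow_char, add_smul]; rfl)
      zero_smul := by
        rintro ⟨w⟩
        exact (hs _ w).trans (by rw [zero_pow hp.out.ne_zero, zero_smul]; rfl) }
  have hsm : ∀ (a : R) (w : Ω[R⁄ℤ]),
    a • (QuotientAddGroup.mk w : Ω[R⁄ℤ] ⧸ exactForms R) = QuotientAddGroup.mk (a ^ p • w) :=
    fun _ _ => rfl
  let δ₀ : R →+ Ω[R⁄ℤ] ⧸ exactForms R := AddMonoidHom.mk'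
    (fun x => QuotientAddGroup.mk (x ^ (p - 1) • D ℤ R x)) (by
      intro x y
      obtain ⟨z, hz⟩ := exists_add_pow_smul_D p x y
      rw [hz, ← QuotientAddGroup.mk_add, QuotientAddGroup.eq]
      refine ⟨-z, ?_⟩
      change D ℤ R (-z) = _
      rw [map_neg]
      abel)
  let δ : Derivation ℤ R (Ω[R⁄ℤ] ⧸ exactForms R) := Derivation.mk' δ₀.toIntLinearMap (by
    intro x y
    change QuotientAddGroup.mk ((x * y) ^ (p - 1) • D ℤ R (x * y)) =
      x • QuotientAddGroup.mk (y ^ (p - 1) • D ℤ R y) +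
        y • QuotientAddGroup.mk (x ^ (p - 1) • D ℤ R x)
    rw [hsm, hsm, ← QuotientAddGroup.mk_add]
    congr 1
    obtain ⟨q, rfl⟩ : ∃ q, p = q + 1 := ⟨p - 1, (Nat.succ_pred hp.out.ne_zero).symm⟩
    rw [Derivation.leibniz, smul_add, Nat.add_sub_cancel]
    simp only [smul_smul]
    congr 2 <;> ring)
  refine ⟨δ.liftKaehlerDifferential.toAddMonoidHom, fun a x => ?_⟩
  change δ.liftKaehlerDifferential (a • D ℤ R x) = _
  rw [map_smul, Derivation.liftKaehlerDifferential_comp_D, mul_smul, ← hsm]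
  rfl

/-- The monomial `∏ γ ^ m γ` in the elements of `Γ`, with all exponents less than `p`. -/
noncomputable def reducedMonomial (p : ℕ) [NeZero p] {A : Type*} [CommRing A] (Γ : Set A)
    (m : Γ →₀ Fin p) : A :=
  m.prod fun γ k => (γ : A) ^ (k : ℕ)

section PBasis

variable {p : ℕ} {A : Type*} [CommRing A] {Γ : Set A}

theorem reducedMonomial_eq_prod [NeZero p] (m : Γ →₀ Fin p) (s : Finset Γ) (hs : m.support ⊆ s) :
    reducedMonomial p Γ m = ∏ γ ∈ s, (γ : A) ^ (m γ : ℕ) :=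
  Finsupp.prod_of_support_subset m hs _ (by simp)

theorem reducedMonomial_zero [NeZero p] : reducedMonomial p Γ 0 = 1 := by
  simp [reducedMonomial]

theorem reducedMonomial_single [NeZero p] (γ : Γ) (k : Fin p) :
    reducedMonomial p Γ (Finsupp.single γ k) = (γ : A) ^ (k : ℕ) := by
  simp [reducedMonomial]

theorem exists_reducedMonomial_mul [NeZero p] (m n : Γ →₀ Fin p) :
    ∃ c : A, reducedMonomial p Γ m * reducedMonomial p Γ n =
      c ^ p * reducedMonomial p Γ (m + n) := by
  classical
  let s := m.support ∪ n.support
  refine ⟨∏ γ ∈ s, (γ : A) ^ (((m γ : ℕ) + n γ) / p), ?_⟩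
  rw [reducedMonomial_eq_prod m s Finset.subset_union_left,
    reducedMonomial_eq_prod n s Finset.subset_union_right,
    reducedMonomial_eq_prod (m + n) s Finsupp.support_add, ← Finset.prod_pow,
    ← Finset.prod_mul_distrib, ← Finset.prod_mul_distrib]
  refine Finset.prod_congr rfl fun γ _ => ?_
  rw [← pow_add, ← pow_mul, ← pow_add, Finsupp.add_apply, Fin.val_add, mul_comm _ p,
    Nat.div_add_mod]

theorem IsPBasis.mem_closure [hp : Fact p.Prime] (hΓ : IsPBasis p Γ) (a : A) :
    a ∈ AddSubgroup.closure
      (Set.range fun t : A × (Γ →₀ Fin p) => t.1 ^ p * reducedMonomial p Γ t.2) := by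
  have hmem : ∀ (x : A) (m : Γ →₀ Fin p), x ^ p * reducedMonomial p Γ m ∈ AddSubgroup.closure
      (Set.range fun t : A × (Γ →₀ Fin p) => t.1 ^ p * reducedMonomial p Γ t.2) :=
    fun x m => AddSubgroup.subset_closure ⟨(x, m), rfl⟩
  have ha : a ∈ Subring.closure ((Set.range fun a : A => a ^ p) ∪ Γ) := by
    rw [hΓ.1]; trivial
  induction ha using Subring.closure_induction with
  | mem x hx =>
    rcases hx with ⟨y, rfl⟩ | hx
    · simpa [reducedMonomial_zero] using hmem y 0
    · have := hmem 1 (Finsupp.single ⟨x, hx⟩ ⟨1, hp.out.one_lt⟩)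
      simpa [reducedMonomial_single] using this
  | zero => exact zero_mem _
  | one => simpa [reducedMonomial_zero] using hmem 1 0
  | add x y _ _ hx hy => exact add_mem hx hy
  | neg x _ hx => exact neg_mem hx
  | mul x y hx' hy' hx hy =>
    clear hx' hy'
    induction hx, hy using AddSubgroup.closure_induction₂ with
    | mem x y hx hy =>
      obtain ⟨⟨x, m⟩, rfl⟩ := hx
      obtain ⟨⟨y, n⟩, rfl⟩ := hy
      obtain ⟨c, hc⟩ := exists_reducedMonomial_mul (A := A) m n
      have := hmem (x * y * c) (m + n)
      rw [mul_pow, mul_assoc, ← hc] at this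
      convert this using 1
      ring
    | zero_left x _ => simp
    | zero_right x _ => simp
    | add_left x y z _ _ _ hx hy => rw [add_mul]; exact add_mem hx hy
    | add_right x y z _ _ _ hx hy => rw [mul_add]; exact add_mem hx hy
    | neg_left x y _ _ hx => rw [neg_mul]; exact neg_mem hx
    | neg_right x y _ _ hx => rw [mul_neg]; exact neg_mem hx

theorem IsPBasis.eq_zero_of_sum_eq_zero [hp : Fact p.Prime] [IsDomain A] (hΓ : IsPBasis p Γ)
    (s : Finset (Γ →₀ Fin p)) (x : (Γ →₀ Fin p) → A)
    (h : ∑ m ∈ s, x m ^ p * reducedMonomial p Γ m = 0) : ∀ m ∈ s, x m = 0 := by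
  classical
  let S : Finset Γ := s.biUnion Finsupp.support
  have hS : ∀ m ∈ s, m.support ⊆ S := fun m hm => Finset.subset_biUnion_of_mem _ hm
  let ε := S.equivFin
  let ρ : (Γ →₀ Fin p) → Fin S.card → Fin p := fun m i => m (ε.symm i)
  have hρ : ∀ m ∈ s, ∀ n ∈ s, ρ m = ρ n → m = n := by
    intro m hm n hn hmn
    ext1 γ
    by_cases hγ : γ ∈ S
    · simpa [ρ] using congrFun hmn (ε ⟨γ, hγ⟩)
    · rw [Finsupp.notMem_support_iff.mp fun h => hγ (hS m hm h),
        Finsupp.notMem_support_iff.mp fun h => hγ (hS n hn h)]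
  have hprod : ∀ m ∈ s, reducedMonomial p Γ m =
      ∏ i, (((ε.symm i : Γ) : A)) ^ (ρ m i : ℕ) := by
    intro m hm
    rw [reducedMonomial_eq_prod m S (hS m hm), ← Finset.prod_coe_sort S,
      ← ε.symm.prod_comp]
  have key := hΓ.2 S.card (fun i => ((ε.symm i : Γ) : A))
    (Subtype.val_injective.comp (Subtype.val_injective.comp ε.symm.injective))
    (fun i => (ε.symm i : Γ).2) (fun t => ∑ m ∈ s with ρ m = t, x m ^ p)
    (fun t => sum_mem fun m _ => Subring.subset_closure ⟨x m, rfl⟩) (by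
      rw [← h, ← Finset.sum_fiberwise s ρ]
      refine Finset.sum_congr rfl fun t _ => ?_
      rw [Finset.sum_mul]
      refine Finset.sum_congr rfl fun m hm => ?_
      obtain ⟨hms, rfl⟩ := Finset.mem_filter.mp hm
      rw [hprod m hms])
  intro m hm
  have hfilter : {n ∈ s | ρ n = ρ m} = {m} := by
    ext n
    rw [Finset.mem_filter, Finset.mem_singleton]
    exact ⟨fun h => hρ n h.1 m hm h.2, by rintro rfl; exact ⟨hm, rfl⟩⟩
  have hk := key (ρ m)
  rw [hfilter, Finset.sum_singleton] at hk
  exact eq_zero_of_pow_eq_zero hk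

theorem IsPBasis.span_D_eq_top [CharP A p] (hΓ : IsPBasis p Γ) :
    Submodule.span A (D ℤ A '' Γ) = ⊤ := by
  rw [eq_top_iff, ← KaehlerDifferential.span_range_derivation, Submodule.span_le]
  rintro _ ⟨a, rfl⟩
  have ha : a ∈ Subring.closure ((Set.range fun a : A => a ^ p) ∪ Γ) := by
    rw [hΓ.1]; trivial
  rw [SetLike.mem_coe]
  induction ha using Subring.closure_induction with
  | mem x hx =>
    rcases hx with ⟨y, rfl⟩ | hx
    · rw [D_pow_char]; exact zero_mem _
    · exact Submodule.subset_span ⟨x, hx, rfl⟩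
  | zero => rw [map_zero]; exact zero_mem _
  | one => rw [Derivation.map_one_eq_zero]; exact zero_mem _
  | add x y _ _ hx hy => rw [map_add]; exact add_mem hx hy
  | neg x _ hx => rw [map_neg]; exact neg_mem hx
  | mul x y _ _ hx hy =>
    rw [Derivation.leibniz]
    exact add_mem (Submodule.smul_mem _ _ hy) (Submodule.smul_mem _ _ hx)

end PBasis

theorem exists_eq_pow_mul_algebraMap {p : ℕ} (hp : p ≠ 0) (A : Type*) {F : Type*} [CommRing A]
    [IsDomain A] [Field F] [Algebra A F] [IsFractionRing A F] (x : F) :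
    ∃ (u : F) (a : A), x = u ^ p * algebraMap A F a := by
  obtain ⟨a, b, hb, rfl⟩ := IsFractionRing.div_surjective (A := A) x
  have hb' : algebraMap A F b ≠ 0 := by
    simpa using nonZeroDivisors.ne_zero hb
  refine ⟨(algebraMap A F b)⁻¹, a * b ^ (p - 1), ?_⟩
  obtain ⟨q, rfl⟩ := Nat.exists_eq_succ_of_ne_zero hp
  simp only [map_mul, map_pow, Nat.succ_sub_one, inv_pow, pow_succ]
  field_simp

section FractionField

variable {p : ℕ} [hp : Fact p.Prime] {A : Type*} [CommRing A] [IsDomain A] {Γ : Set A}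

theorem IsPBasis.linearIndependent (hΓ : IsPBasis p Γ) (F : Type*) [Field F] [CharP F p]
    [Algebra A F] [IsFractionRing A F] :
    LinearIndependent (frobenius F p).fieldRange
      fun m : Γ →₀ Fin p => algebraMap A F (reducedMonomial p Γ m) := by
  classical
  rw [linearIndependent_iff']
  intro s g hg
  choose u hu using fun m => (g m).2
  obtain ⟨b, hb⟩ := IsLocalization.exist_integer_multiples (nonZeroDivisors A) s u
  have hb0 : algebraMap A F b ≠ 0 := by
    simp
  choose! y hy using hb
  have hy0 : ∀ m ∈ s, y m = 0 := by
    refine hΓ.eq_zero_of_sum_eq_zero s y (FaithfulSMul.algebraMap_injective A F ?_)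
    rw [map_sum, map_zero, ← mul_zero (algebraMap A F b ^ p), ← hg, Finset.mul_sum]
    refine Finset.sum_congr rfl fun m hm => ?_
    rw [map_mul, map_pow, hy m hm, Subfield.smul_def, ← hu, frobenius_def, Algebra.smul_def,
      smul_eq_mul, mul_pow, mul_assoc]
  intro m hm
  have h := hy m hm
  rw [hy0 m hm, map_zero, Algebra.smul_def] at h
  have hum : u m = 0 := (mul_eq_zero.mp h.symm).resolve_left hb0
  exact Subtype.ext (by rw [← hu, hum, map_zero]; rfl)

theorem IsPBasis.top_le_span (hΓ : IsPBasis p Γ) (F : Type*) [Field F] [CharP F p]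
    [Algebra A F] [IsFractionRing A F] :
    ⊤ ≤ Submodule.span (frobenius F p).fieldRange
      (Set.range fun m : Γ →₀ Fin p => algebraMap A F (reducedMonomial p Γ m)) := by
  rintro x -
  obtain ⟨u, a, rfl⟩ := exists_eq_pow_mul_algebraMap hp.out.ne_zero A x
  have hpow : ∀ (v : F) {y : F}, y ∈ Submodule.span (frobenius F p).fieldRange
      (Set.range fun m : Γ →₀ Fin p => algebraMap A F (reducedMonomial p Γ m)) →
      v ^ p * y ∈ Submodule.span (frobenius F p).fieldRange
      (Set.range fun m : Γ →₀ Fin p => algebraMap A F (reducedMonomial p Γ m)) :=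
    fun v y hy => Submodule.smul_mem _ (⟨v ^ p, v, rfl⟩ : (frobenius F p).fieldRange) hy
  refine hpow u ?_
  induction hΓ.mem_closure a using AddSubgroup.closure_induction with
  | mem x hx =>
    obtain ⟨⟨x, m⟩, rfl⟩ := hx
    rw [map_mul, map_pow]
    exact hpow _ (Submodule.subset_span ⟨m, rfl⟩)
  | zero => rw [map_zero]; exact zero_mem _
  | add x y _ _ hx hy => rw [map_add]; exact add_mem hx hy
  | neg x _ hx => rw [map_neg]; exact neg_mem hx

/-- The basis of the fraction field `F` over `F ^ p` given by the reduced monomials in a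
`p`-basis of `A`. -/
noncomputable def IsPBasis.basis (hΓ : IsPBasis p Γ) (F : Type*) [Field F] [CharP F p]
    [Algebra A F] [IsFractionRing A F] :
    Module.Basis (Γ →₀ Fin p) (frobenius F p).fieldRange F :=
  .mk (hΓ.linearIndependent F) (hΓ.top_le_span F)

variable (hΓ : IsPBasis p Γ) (F : Type*) [Field F] [CharP F p] [Algebra A F] [IsFractionRing A F]

theorem IsPBasis.basis_apply (m : Γ →₀ Fin p) :
    hΓ.basis F m = algebraMap A F (reducedMonomial p Γ m) :=
  Module.Basis.mk_apply _ _ m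

/-- The projection of `F` onto the line spanned by the reduced monomial of exponent `m`. -/
noncomputable def IsPBasis.component (m : Γ →₀ Fin p) : F →ₗ[(frobenius F p).fieldRange] F :=
  ((hΓ.basis F).coord m).smulRight (hΓ.basis F m)

theorem IsPBasis.component_self (m : Γ →₀ Fin p) (x : F) :
    hΓ.component F m (x ^ p * algebraMap A F (reducedMonomial p Γ m)) =
      x ^ p * algebraMap A F (reducedMonomial p Γ m) := by
  have := (hΓ.component F m).map_smul (⟨x ^ p, x, rfl⟩ : (frobenius F p).fieldRange)
    (hΓ.basis F m)
  rw [← hΓ.basis_apply F m]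
  refine this.trans ?_
  simp [IsPBasis.component]
  rfl

theorem IsPBasis.component_of_ne {m n : Γ →₀ Fin p} (h : n ≠ m) (x : F) :
    hΓ.component F m (x ^ p * algebraMap A F (reducedMonomial p Γ n)) = 0 := by
  have := (hΓ.component F m).map_smul (⟨x ^ p, x, rfl⟩ : (frobenius F p).fieldRange)
    (hΓ.basis F n)
  rw [← hΓ.basis_apply F n]
  refine this.trans ?_
  simp [IsPBasis.component, Finsupp.single_eq_of_ne h.symm]

theorem IsPBasis.component_mem_range (m : Γ →₀ Fin p) {x : F} (hx : x ∈ (algebraMap A F).range) :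
    hΓ.component F m x ∈ (algebraMap A F).range := by
  obtain ⟨a, rfl⟩ := hx
  induction hΓ.mem_closure a using AddSubgroup.closure_induction with
  | mem x hx =>
    obtain ⟨⟨x, n⟩, rfl⟩ := hx
    dsimp only
    rw [map_mul, map_pow]
    by_cases h : n = m
    · subst h
      rw [hΓ.component_self]
      exact ⟨x ^ p * reducedMonomial p Γ n, by rw [map_mul, map_pow]⟩
    · rw [hΓ.component_of_ne F h]
      exact zero_mem _
  | zero => rw [map_zero, map_zero]; exact zero_mem _
  | add x y _ _ hx hy => rw [map_add, map_add]; exact add_mem hx hy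
  | neg x _ hx => rw [map_neg, map_neg]; exact neg_mem hx

theorem IsPBasis.exists_component_zero (x : F) : ∃ u : F, hΓ.component F 0 x = u ^ p := by
  obtain ⟨u, hu⟩ := ((hΓ.basis F).coord 0 x).2
  refine ⟨u, ?_⟩
  rw [← frobenius_def, hu]
  simp [IsPBasis.component, hΓ.basis_apply, reducedMonomial_zero, Subfield.smul_def]

theorem IsPBasis.sum_component (x : F) :
    ∑ m ∈ ((hΓ.basis F).repr x).support, hΓ.component F m x = x :=
  (hΓ.basis F).linearCombination_repr x

/-- The logarithmic derivation `γ ∂/∂γ` of `F` as a linear map. -/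
noncomputable def IsPBasis.logDerivLinear (γ : Γ) : F →ₗ[(frobenius F p).fieldRange] F :=
  (hΓ.basis F).constr (frobenius F p).fieldRange fun m => ((m γ : ℕ) : F) * hΓ.basis F m

theorem IsPBasis.logDerivLinear_basis (γ : Γ) (m : Γ →₀ Fin p) :
    hΓ.logDerivLinear F γ (hΓ.basis F m) = ((m γ : ℕ) : F) * hΓ.basis F m :=
  (hΓ.basis F).constr_basis _ _ m

theorem IsPBasis.component_logDerivLinear (γ : Γ) (m : Γ →₀ Fin p) (x : F) :
    hΓ.component F m (hΓ.logDerivLinear F γ x) = ((m γ : ℕ) : F) * hΓ.component F m x := by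
  have : (hΓ.component F m).comp (hΓ.logDerivLinear F γ) =
      (m γ : ℕ) • hΓ.component F m := by
    refine (hΓ.basis F).ext fun n => ?_
    rw [LinearMap.comp_apply, logDerivLinear_basis, ← nsmul_eq_mul, map_nsmul,
      LinearMap.smul_apply]
    by_cases h : n = m
    · rw [h]
    · have := hΓ.component_of_ne F h 1
      rw [one_pow, one_mul, ← hΓ.basis_apply] at this
      rw [this, smul_zero, smul_zero]
  rw [← LinearMap.comp_apply, this, LinearMap.smul_apply, nsmul_eq_mul]

theorem IsPBasis.logDerivLinear_mul (γ : Γ) (x y : F) :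
    hΓ.logDerivLinear F γ (x * y) =
      x * hΓ.logDerivLinear F γ y + hΓ.logDerivLinear F γ x * y := by
  let μ := LinearMap.mul (frobenius F p).fieldRange F
  let θ := hΓ.logDerivLinear F γ
  suffices h : μ.compr₂ θ = μ.compl₂ θ + μ.comp θ from
    DFunLike.congr_fun (DFunLike.congr_fun h x) y
  refine (hΓ.basis F).ext fun m => (hΓ.basis F).ext fun n => ?_
  change θ (hΓ.basis F m * hΓ.basis F n) =
    hΓ.basis F m * θ (hΓ.basis F n) + θ (hΓ.basis F m) * hΓ.basis F n
  obtain ⟨c, hc⟩ := exists_reducedMonomial_mul (A := A) m n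
  have hc' : hΓ.basis F m * hΓ.basis F n = algebraMap A F c ^ p * hΓ.basis F (m + n) := by
    rw [hΓ.basis_apply, hΓ.basis_apply, hΓ.basis_apply, ← map_mul, hc, map_mul, map_pow]
  have hθ : θ (algebraMap A F c ^ p * hΓ.basis F (m + n)) =
      algebraMap A F c ^ p * θ (hΓ.basis F (m + n)) :=
    θ.map_smul (⟨algebraMap A F c ^ p, algebraMap A F c, rfl⟩ : (frobenius F p).fieldRange) _
  have hcast : (((m + n) γ : ℕ) : F) = (m γ : ℕ) + (n γ : ℕ) := by
    rw [Finsupp.add_apply, Fin.val_add, ← CharP.natCast_eq_natCast_mod, Nat.cast_add]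
  rw [hc', hθ, hΓ.logDerivLinear_basis, hΓ.logDerivLinear_basis, hΓ.logDerivLinear_basis,
    mul_left_comm, ← hc', hcast]
  ring

/-- The logarithmic derivation `γ ∂/∂γ` of `F`. -/
noncomputable def IsPBasis.logDeriv (γ : Γ) : Derivation ℤ F F :=
  Derivation.mk' (hΓ.logDerivLinear F γ).toAddMonoidHom.toIntLinearMap fun x y =>
    (hΓ.logDerivLinear_mul F γ x y).trans (by
      rw [mul_comm (hΓ.logDerivLinear F γ x)]; rfl)

theorem IsPBasis.component_logDeriv (γ : Γ) (m : Γ →₀ Fin p) (x : F) :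
    hΓ.component F m (hΓ.logDeriv F γ x) = ((m γ : ℕ) : F) * hΓ.component F m x :=
  hΓ.component_logDerivLinear F γ m x

theorem IsPBasis.component_mem_range_of_logDeriv {g : F}
    (h : ∀ γ, hΓ.logDeriv F γ g ∈ (algebraMap A F).range) {m : Γ →₀ Fin p} (hm : m ≠ 0) :
    hΓ.component F m g ∈ (algebraMap A F).range := by
  obtain ⟨γ, hγ⟩ := Finsupp.ne_iff.mp hm
  have hcop : Nat.Coprime (m γ : ℕ) p := by
    refine (Nat.coprime_of_lt_prime ?_ (m γ).2 hp.out).symm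
    exact fun h0 => hγ (Fin.ext h0)
  obtain ⟨t, -, ht⟩ := Nat.exists_mul_mod_eq_one_of_coprime hcop hp.out.one_lt
  have ht' : (t : F) * ((m γ : ℕ) : F) = 1 := by
    rw [mul_comm, ← Nat.cast_mul, CharP.natCast_eq_natCast_mod F p, ht, Nat.cast_one]
  have := hΓ.component_mem_range F m (h γ)
  rw [component_logDeriv] at this
  rw [← one_mul (hΓ.component F m g), ← ht', mul_assoc]
  exact mul_mem (natCast_mem _ t) this

/-- The `γ`-coordinate of a form on `F`, with respect to the forms `dγ / γ`. -/
noncomputable def IsPBasis.logCoord (γ : Γ) : Ω[F⁄ℤ] →ₗ[F] F :=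
  (hΓ.logDeriv F γ).liftKaehlerDifferential

theorem IsPBasis.logCoord_D (γ : Γ) (x : F) :
    hΓ.logCoord F γ (D ℤ F x) = hΓ.logDeriv F γ x :=
  Derivation.liftKaehlerDifferential_comp_D _ _

open scoped Classical in
theorem IsPBasis.logDeriv_mem (γ δ : Γ) :
    hΓ.logDeriv F γ (algebraMap A F δ) = if δ = γ then algebraMap A F δ else 0 := by
  have h1 : hΓ.basis F (Finsupp.single δ ⟨1, hp.out.one_lt⟩) = algebraMap A F δ := by
    rw [hΓ.basis_apply, reducedMonomial_single, pow_one]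
  rw [← h1]
  refine (hΓ.logDerivLinear_basis F γ _).trans ?_
  rw [Finsupp.single_apply]
  split_ifs <;> simp

theorem IsPBasis.algebraMap_ne_zero (hΓ : IsPBasis p Γ) (γ : Γ) : algebraMap A F γ ≠ 0 := by
  have := (hΓ.basis F).ne_zero (Finsupp.single γ ⟨1, hp.out.one_lt⟩)
  rwa [hΓ.basis_apply, reducedMonomial_single, pow_one] at this

theorem IsPBasis.span_D_algebraMap_eq_top (hΓ : IsPBasis p Γ) [CharP A p] :
    Submodule.span F (Set.range fun γ : Γ => D ℤ F (algebraMap A F γ)) = ⊤ := by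
  rw [eq_top_iff, ← KaehlerDifferential.span_range_derivation, Submodule.span_le]
  rintro _ ⟨x, rfl⟩
  obtain ⟨u, a, rfl⟩ := exists_eq_pow_mul_algebraMap hp.out.ne_zero A x
  rw [D_pow_char_mul]
  refine Submodule.smul_mem _ _ ?_
  rw [← KaehlerDifferential.map_D ℤ ℤ A F]
  have ha : D ℤ A a ∈ Submodule.span A (D ℤ A '' Γ) := by
    rw [hΓ.span_D_eq_top]; trivial
  generalize D ℤ A a = w at ha ⊢
  induction ha using Submodule.span_induction with
  | mem w hw =>
    obtain ⟨γ, hγ, rfl⟩ := hw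
    rw [KaehlerDifferential.map_D]
    exact Submodule.subset_span ⟨⟨γ, hγ⟩, rfl⟩
  | zero => rw [map_zero]; exact zero_mem _
  | add v w _ _ hv hw => rw [map_add]; exact add_mem hv hw
  | smul a w _ hw =>
    rw [map_smul, ← algebraMap_smul F a]
    exact Submodule.smul_mem _ _ hw

theorem IsPBasis.ext_logCoord [CharP A p] {v w : Ω[F⁄ℤ]}
    (h : ∀ γ, hΓ.logCoord F γ v = hΓ.logCoord F γ w) : v = w := by
  classical
  rw [← sub_eq_zero]
  have hmem : v - w ∈ Submodule.span F (Set.range fun γ : Γ => D ℤ F (algebraMap A F γ)) := by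
    rw [hΓ.span_D_algebraMap_eq_top F]; trivial
  obtain ⟨c, hc⟩ := Finsupp.mem_span_range_iff_exists_finsupp.mp hmem
  suffices c = 0 by rw [← hc, this, Finsupp.sum_zero_index]
  ext1 γ
  have hγ : hΓ.logCoord F γ (v - w) = 0 := by rw [map_sub, h, sub_self]
  rw [← hc, map_finsuppSum] at hγ
  simp only [map_smul, logCoord_D, logDeriv_mem, smul_eq_mul, mul_ite, mul_zero,
    Finsupp.sum_ite_eq'] at hγ
  by_contra hne
  rw [if_pos (Finsupp.mem_support_iff.mpr hne)] at hγ
  exact mul_ne_zero hne (hΓ.algebraMap_ne_zero F γ) hγ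

end FractionField

section InverseCartier

/-- The inverse Cartier operator `Ω¹_R → Ω¹_R / dR`, sending `a dx` to the class of
`a ^ p * x ^ (p - 1) dx`. -/
noncomputable def inverseCartier (p : ℕ) [Fact p.Prime] (R : Type*) [CommRing R] [CharP R p] :
    Ω[R⁄ℤ] →+ Ω[R⁄ℤ] ⧸ exactForms R :=
  (exists_inverseCartier p R).choose

theorem inverseCartier_smul_D {p : ℕ} [Fact p.Prime] {R : Type*} [CommRing R] [CharP R p]
    (a x : R) : inverseCartier p R (a • D ℤ R x) =
      QuotientAddGroup.mk ((a ^ p * x ^ (p - 1)) • D ℤ R x) :=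
  (exists_inverseCartier p R).choose_spec a x

theorem mem_BnSet_succ_iff {p : ℕ} [hp : Fact p.Prime] {R : Type*} [CommRing R] [CharP R p]
    {n : ℕ} {w : Ω[R⁄ℤ]} : w ∈ BnSet p (n + 1) R ↔
      ∃ η ∈ BnSet p n R, QuotientAddGroup.mk w = inverseCartier p R η := by
  have hφ : ∀ f : Fin n → R, inverseCartier p R
      (∑ i : Fin n, f i ^ (p ^ (n - 1 - (i : ℕ)) - 1) • D ℤ R (f i)) =
      QuotientAddGroup.mk (∑ i : Fin n, f i ^ (p ^ (n - (i : ℕ)) - 1) • D ℤ R (f i)) := by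
    intro f
    rw [map_sum, QuotientAddGroup.mk_sum]
    refine Finset.sum_congr rfl fun i _ => ?_
    rw [inverseCartier_smul_D, ← pow_mul, ← pow_add]
    congr 4
    obtain ⟨k, hk⟩ : ∃ k, n - (i : ℕ) = k + 1 := ⟨n - i - 1, by omega⟩
    have hk' : n - 1 - (i : ℕ) = k := by omega
    rw [hk, hk', pow_succ]
    obtain ⟨q, hq⟩ : ∃ q, p ^ k = q + 1 :=
      ⟨p ^ k - 1, (Nat.succ_pred (pow_ne_zero _ hp.out.ne_zero)).symm⟩
    have := hp.out.one_lt
    rw [hq, Nat.add_sub_cancel, add_mul, one_mul]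
    omega
  constructor
  · rintro ⟨f, rfl⟩
    refine ⟨_, ⟨fun i => f i.castSucc, rfl⟩, ?_⟩
    rw [hφ, Fin.sum_univ_castSucc, QuotientAddGroup.eq]
    refine ⟨-f (Fin.last n), ?_⟩
    change D ℤ R (-f (Fin.last n)) = _
    simp
  · rintro ⟨_, ⟨f, rfl⟩, hw⟩
    rw [hφ, eq_comm, QuotientAddGroup.eq] at hw
    obtain ⟨g, hg⟩ := hw
    change D ℤ R g = _ at hg
    refine ⟨Fin.snoc f g, ?_⟩
    rw [Fin.sum_univ_castSucc]
    simp [hg]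

theorem map_mk_eq_inverseCartier {p : ℕ} [Fact p.Prime] {A : Type*} [CommRing A] [CharP A p]
    (F : Type*) [CommRing F] [CharP F p] [Algebra A F] {v w : Ω[A⁄ℤ]}
    (h : QuotientAddGroup.mk w = inverseCartier p A v) :
    QuotientAddGroup.mk (KaehlerDifferential.map ℤ ℤ A F w) =
      inverseCartier p F (KaehlerDifferential.map ℤ ℤ A F v) := by
  let ψ : Ω[A⁄ℤ] ⧸ exactForms A →+ Ω[F⁄ℤ] ⧸ exactForms F :=
    QuotientAddGroup.map _ _ (KaehlerDifferential.map ℤ ℤ A F).toAddMonoidHom (by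
      rintro _ ⟨x, rfl⟩
      exact ⟨algebraMap A F x, (KaehlerDifferential.map_D ℤ ℤ A F x).symm⟩)
  have hψ : ∀ w : Ω[A⁄ℤ], ψ (QuotientAddGroup.mk w) =
    QuotientAddGroup.mk (KaehlerDifferential.map ℤ ℤ A F w) := fun _ => rfl
  rw [← hψ, h]
  clear h
  have hv : v ∈ Submodule.span A (Set.range (D ℤ A)) := by
    rw [KaehlerDifferential.span_range_derivation]; trivial
  induction hv using Submodule.closure_induction with
  | zero => simp only [map_zero]
  | add x y _ _ hx hy => simp only [map_add, hx, hy]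
  | smul_mem a x hx =>
    obtain ⟨x, rfl⟩ := hx
    rw [inverseCartier_smul_D, hψ]
    simp only [map_smul, KaehlerDifferential.map_D]
    rw [← algebraMap_smul F (_ * _), ← algebraMap_smul F a, inverseCartier_smul_D, map_mul,
      map_pow, map_pow]

end InverseCartier

section FractionField

variable {p : ℕ} [hp : Fact p.Prime] {A : Type*} [CommRing A] [IsDomain A] [CharP A p] {Γ : Set A}
  (hΓ : IsPBasis p Γ) (F : Type*) [Field F] [CharP F p] [Algebra A F] [IsFractionRing A F]

theorem IsPBasis.logCoord_map_mem_range (γ : Γ) (w : Ω[A⁄ℤ]) :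
    hΓ.logCoord F γ (KaehlerDifferential.map ℤ ℤ A F w) ∈ (algebraMap A F).range := by
  classical
  have hw : w ∈ Submodule.span A (D ℤ A '' Γ) := by
    rw [hΓ.span_D_eq_top]; trivial
  induction hw using Submodule.closure_induction with
  | zero => rw [map_zero, map_zero]; exact zero_mem _
  | add v w _ _ hv hw => rw [map_add, map_add]; exact add_mem hv hw
  | smul_mem a x hx =>
    obtain ⟨δ, hδ, rfl⟩ := hx
    rw [map_smul, KaehlerDifferential.map_D, ← algebraMap_smul F a, map_smul, logCoord_D,
      hΓ.logDeriv_mem F γ ⟨δ, hδ⟩, smul_eq_mul]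
    refine mul_mem ⟨a, rfl⟩ ?_
    split_ifs
    exacts [⟨δ, rfl⟩, zero_mem _]

theorem IsPBasis.exists_D_eq_of_map_eq_D (hΓ : IsPBasis p Γ)
    (hinj : Function.Injective (KaehlerDifferential.map ℤ ℤ A F))
    {w : Ω[A⁄ℤ]} {g : F} (h : KaehlerDifferential.map ℤ ℤ A F w = D ℤ F g) :
    ∃ f : A, w = D ℤ A f := by
  have hg : ∀ γ, hΓ.logDeriv F γ g ∈ (algebraMap A F).range := fun γ => by
    rw [← logCoord_D, ← h]
    exact hΓ.logCoord_map_mem_range F γ w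
  have key : ∀ m, ∃ a : A, D ℤ F (hΓ.component F m g) = D ℤ F (algebraMap A F a) := by
    intro m
    by_cases hm : m = 0
    · obtain ⟨u, hu⟩ := hΓ.exists_component_zero F g
      exact ⟨0, by rw [hm, hu, D_pow_char, map_zero, map_zero]⟩
    · obtain ⟨a, ha⟩ := hΓ.component_mem_range_of_logDeriv F hg hm
      exact ⟨a, by rw [ha]⟩
  choose a ha using key
  refine ⟨∑ m ∈ ((hΓ.basis F).repr g).support, a m, hinj ?_⟩
  rw [h, KaehlerDifferential.map_D, map_sum, map_sum]
  conv_lhs => rw [← hΓ.sum_component F g, map_sum]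
  exact Finset.sum_congr rfl fun m _ => ha m

theorem IsPBasis.component_zero_logCoord {w η : Ω[F⁄ℤ]}
    (h : QuotientAddGroup.mk w = inverseCartier p F η) (γ : Γ) :
    hΓ.component F 0 (hΓ.logCoord F γ w) = hΓ.logCoord F γ η ^ p := by
  classical
  let ψ : Ω[F⁄ℤ] ⧸ exactForms F →+ F :=
    QuotientAddGroup.lift _ ((hΓ.component F 0).toAddMonoidHom.comp
      (hΓ.logCoord F γ).toAddMonoidHom) (by
      rintro _ ⟨x, rfl⟩
      change hΓ.component F 0 (hΓ.logCoord F γ (D ℤ F x)) = 0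
      rw [logCoord_D, component_logDeriv]
      simp)
  have hψ : ∀ w : Ω[F⁄ℤ], ψ (QuotientAddGroup.mk w) =
    hΓ.component F 0 (hΓ.logCoord F γ w) := fun _ => rfl
  rw [← hψ, h]
  clear h
  have hη : η ∈ Submodule.span F (Set.range fun γ : Γ => D ℤ F (algebraMap A F γ)) := by
    rw [hΓ.span_D_algebraMap_eq_top F]; trivial
  induction hη using Submodule.closure_induction with
  | zero => simp only [map_zero, zero_pow hp.out.ne_zero]
  | add x y _ _ hx hy => simp only [map_add, hx, hy, add_pow_char]
  | smul_mem a x hx =>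
    obtain ⟨δ, rfl⟩ := hx
    have hcoord : ∀ b : F, hΓ.logCoord F γ (b • D ℤ F (algebraMap A F δ)) =
        if δ = γ then b * algebraMap A F δ else 0 := by
      intro b
      rw [map_smul, logCoord_D, logDeriv_mem, smul_eq_mul, mul_ite, mul_zero]
    dsimp only
    rw [inverseCartier_smul_D, hψ, hcoord, hcoord]
    split_ifs
    · have := hΓ.component_self F 0 (a * algebraMap A F δ)
      rw [reducedMonomial_zero, map_one, mul_one] at this
      rw [mul_assoc, pow_sub_one_mul hp.out.ne_zero, ← mul_pow, this]
    · rw [map_zero, zero_pow hp.out.ne_zero]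

theorem IsPBasis.exists_component_zero_logCoord_map (w : Ω[A⁄ℤ]) :
    ∃ v : Ω[A⁄ℤ], ∀ γ, hΓ.component F 0 (hΓ.logCoord F γ (KaehlerDifferential.map ℤ ℤ A F w)) =
      hΓ.logCoord F γ (KaehlerDifferential.map ℤ ℤ A F v) ^ p := by
  classical
  have hw : w ∈ Submodule.span A (D ℤ A '' Γ) := by
    rw [hΓ.span_D_eq_top]; trivial
  induction hw using Submodule.closure_induction with
  | zero => exact ⟨0, fun γ => by simp only [map_zero, zero_pow hp.out.ne_zero]⟩
  | add x y _ _ hx hy =>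
    obtain ⟨v, hv⟩ := hx
    obtain ⟨v', hv'⟩ := hy
    exact ⟨v + v', fun γ => by simp only [map_add, hv, hv', add_pow_char]⟩
  | smul_mem a x hx =>
    obtain ⟨δ, hδ, rfl⟩ := hx
    obtain ⟨δ, rfl⟩ : ∃ δ' : Γ, δ = δ' := ⟨⟨δ, hδ⟩, rfl⟩
    have hcoord : ∀ (a : A) (γ : Γ),
        hΓ.logCoord F γ (KaehlerDifferential.map ℤ ℤ A F (a • D ℤ A δ)) =
          if δ = γ then algebraMap A F (a * δ) else 0 := by
      intro a γ
      rw [map_smul, KaehlerDifferential.map_D, ← algebraMap_smul F a, map_smul, logCoord_D,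
        logDeriv_mem, smul_eq_mul, mul_ite, mul_zero, map_mul]
    induction hΓ.mem_closure a using AddSubgroup.closure_induction with
    | mem a ha =>
      obtain ⟨⟨x, m⟩, rfl⟩ := ha
      dsimp only
      have hpred : p - 1 < p := Nat.pred_lt hp.out.ne_zero
      by_cases hm : m = Finsupp.single δ ⟨p - 1, hpred⟩
      · refine ⟨x • D ℤ A δ, fun γ => ?_⟩
        rw [hcoord, hcoord, hm, reducedMonomial_single]
        split_ifs
        · have := hΓ.component_self F 0 (algebraMap A F (x * δ))
          rw [reducedMonomial_zero, map_one, mul_one] at this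
          rw [mul_assoc, pow_sub_one_mul hp.out.ne_zero, ← mul_pow, map_pow, this]
        · rw [map_zero, zero_pow hp.out.ne_zero]
      · refine ⟨0, fun γ => ?_⟩
        rw [hcoord, map_zero, map_zero, zero_pow hp.out.ne_zero]
        split_ifs
        · let s : Γ →₀ Fin p := Finsupp.single δ ⟨1, hp.out.one_lt⟩
          have hs : m + s ≠ 0 := by
            intro h
            refine hm (add_right_cancel (b := s) (h.trans ?_))
            rw [← Finsupp.single_add, eq_comm, Finsupp.single_eq_zero]
            refine Fin.ext ?_
            rw [Fin.val_add, Nat.sub_add_cancel hp.out.one_lt.le, Nat.mod_self]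
            rfl
          obtain ⟨c, hc⟩ := exists_reducedMonomial_mul (A := A) m s
          rw [reducedMonomial_single, pow_one] at hc
          rw [mul_assoc, hc, ← mul_assoc, ← mul_pow, map_mul, map_pow]
          exact hΓ.component_of_ne F hs _
        · rw [map_zero]
    | zero => exact ⟨0, fun γ => by simp only [zero_smul, map_zero, zero_pow hp.out.ne_zero]⟩
    | add x y _ _ hx hy =>
      obtain ⟨v, hv⟩ := hx
      obtain ⟨v', hv'⟩ := hy
      exact ⟨v + v', fun γ => by simp only [add_smul, map_add, hv, hv', add_pow_char]⟩
    | neg x _ hx =>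
      obtain ⟨v, hv⟩ := hx
      exact ⟨-v, fun γ => by
        simp only [neg_smul, map_neg, hv]
        exact (map_neg (frobenius F p) _).symm⟩

end FractionField

/-- Let `A` be an integral domain of characteristic `p` with a `p`-basis, with fraction field
`F`, such that `Ω¹_A` injects into `Ω¹_F`.  Then `Ω¹_A ∩ B_{n,F} = B_{n,A}` for all `n`:
a form on `A` lies in `B_{n,F}` after base change to `F` iff it lies in `B_{n,A}`
(in particular `Ω¹_A/B_{n,A} → Ω¹_F/B_{n,F}` is injective). -/
theorem omega_inter_Bn_eq (p n : ℕ) [Fact p.Prime] {A F : Type*} [CommRing A] [IsDomain A]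
    [CharP A p] [Field F] [Algebra A F] [IsFractionRing A F]
    (Γ : Set A) (hΓ : IsPBasis p Γ)
    (hinj : Function.Injective (KaehlerDifferential.map ℤ ℤ A F))
    (w : Ω[A⁄ℤ]) :
    KaehlerDifferential.map ℤ ℤ A F w ∈ BnSet p n F ↔ w ∈ BnSet p n A := by
  have : CharP F p := charP_of_injective_algebraMap (FaithfulSMul.algebraMap_injective A F) p
  induction n generalizing w with
  | zero => simp [BnSet, map_eq_zero_iff _ hinj]
  | succ n ih =>
    rw [mem_BnSet_succ_iff, mem_BnSet_succ_iff]
    constructor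
    · rintro ⟨η, hη, h⟩
      obtain ⟨v, hv⟩ := hΓ.exists_component_zero_logCoord_map F w
      obtain rfl : KaehlerDifferential.map ℤ ℤ A F v = η := hΓ.ext_logCoord F fun γ =>
        frobenius_inj F p ((hv γ).symm.trans (hΓ.component_zero_logCoord F h γ))
      refine ⟨v, (ih v).mp hη, ?_⟩
      obtain ⟨w', hw'⟩ := QuotientAddGroup.mk_surjective (inverseCartier p A v)
      rw [← map_mk_eq_inverseCartier F hw', QuotientAddGroup.eq] at h
      obtain ⟨g, hg⟩ := h
      change D ℤ F g = _ at hg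
      rw [← map_neg, ← map_add] at hg
      obtain ⟨f, hf⟩ := hΓ.exists_D_eq_of_map_eq_D F hinj hg.symm
      rw [← hw', QuotientAddGroup.eq]
      exact ⟨f, hf.symm⟩
    · rintro ⟨v, hv, h⟩
      exact ⟨_, (ih v).mpr hv, map_mk_eq_inverseCartier F h⟩
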